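/- Let (G,Ω) be an abundant transitive ℓ-permutation group satisfying hypothesis (†), and let Δ ∈ T and h ∈ Q_Δ. Then C²_G(W_h) = rst(Δ). Consequently, if β ∈ Δ and h' ∈ rst(Δ) with V(β, βh') = κ(Δ), then C²_G(W_h) = C²_G(W_{h'}); in particular C²_G(W_h) = C²_G(W_{h'}) for all h,h' ∈ Q_Δ. -/

import Mathlib

/-!  Common framework for ℓ-permutation groups on a totally ordered set. -/

namespace LPerm

variable {Ω : Type*} [LinearOrder Ω]

/-- Pointwise join of two order automorphisms of a totally ordered set. -/
def autSup (f g : Ω ≃o Ω) : Ω ≃o Ω :=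
  Equiv.toOrderIso
    { toFun := fun α => max (f α) (g α)
      invFun := fun α => min (f.symm α) (g.symm α)
      left_inv := by
        intro α
        dsimp only
        rcases le_total (f α) (g α) with h | h
        · rw [max_eq_right h]
          have h1 : α ≤ f.symm (g α) := by
            have := f.symm.monotone h
            simpa using this
          rw [g.symm_apply_apply, min_eq_right h1]
        · rw [max_eq_left h]
          have h1 : α ≤ g.symm (f α) := by
            have := g.symm.monotone h
            simpa using this
          rw [f.symm_apply_apply, min_eq_left h1]
      right_inv := by
        intro α
        dsimp only
        rcases le_total (f.symm α) (g.symm α) with h | h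
        · rw [min_eq_left h]
          have h1 : g (f.symm α) ≤ α := by
            have := g.monotone h
            simpa using this
          rw [f.apply_symm_apply, max_eq_left h1]
        · rw [min_eq_right h]
          have h1 : f (g.symm α) ≤ α := by
            have := f.monotone h
            simpa using this
          rw [g.apply_symm_apply, max_eq_right h1] }
    (f.monotone.max g.monotone)
    (f.symm.monotone.min g.symm.monotone)

/-- Pointwise meet of two order automorphisms of a totally ordered set. -/
def autInf (f g : Ω ≃o Ω) : Ω ≃o Ω :=
  Equiv.toOrderIso
    { toFun := fun α => min (f α) (g α)
      invFun := fun α => max (f.symm α) (g.symm α)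
      left_inv := by
        intro α
        dsimp only
        rcases le_total (f α) (g α) with h | h
        · rw [min_eq_left h]
          have h1 : g.symm (f α) ≤ α := by
            have := g.symm.monotone h
            simpa using this
          rw [f.symm_apply_apply, max_eq_left h1]
        · rw [min_eq_right h]
          have h1 : f.symm (g α) ≤ α := by
            have := f.symm.monotone h
            simpa using this
          rw [g.symm_apply_apply, max_eq_right h1]
      right_inv := by
        intro α
        dsimp only
        rcases le_total (f.symm α) (g.symm α) with h | h
        · rw [max_eq_right h]
          have h1 : α ≤ f (g.symm α) := by
            have := f.monotone h
            simpa using this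
          rw [g.apply_symm_apply, min_eq_right h1]
        · rw [max_eq_left h]
          have h1 : α ≤ g (f.symm α) := by
            have := g.monotone h
            simpa using this
          rw [f.apply_symm_apply, min_eq_left h1] }
    (f.monotone.min g.monotone)
    (f.symm.monotone.max g.symm.monotone)


/-- The pointwise order on order automorphisms: `f ≤ g` iff `f α ≤ g α` for all `α`. -/
def autLe (f g : Ω ≃o Ω) : Prop := ∀ α : Ω, f α ≤ g α

/-- `|g| = g ∨ g⁻¹`. -/
def autAbs (g : Ω ≃o Ω) : Ω ≃o Ω := autSup g g⁻¹

/-- The support of an automorphism. -/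
def supp (g : Ω ≃o Ω) : Set Ω := {α | g α ≠ α}

/-- Conjugation, written `h^g = g⁻¹ h g` in the paper. -/
def aconj (h g : Ω ≃o Ω) : Ω ≃o Ω := g⁻¹ * h * g

/-- The commutator `[a,b] = a⁻¹ b⁻¹ a b`. -/
def pcomm (a b : Ω ≃o Ω) : Ω ≃o Ω := a⁻¹ * b⁻¹ * a * b

/-- `G` is closed under the pointwise lattice operations, i.e. `(G,Ω)` is an
ℓ-permutation group. -/
def SublatticeClosed (G : Subgroup (Ω ≃o Ω)) : Prop :=
  ∀ f g : Ω ≃o Ω, f ∈ G → g ∈ G → autSup f g ∈ G ∧ autInf f g ∈ G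

/-- `(G,Ω)` is transitive. -/
def IsTransitive (G : Subgroup (Ω ≃o Ω)) : Prop :=
  ∀ α β : Ω, ∃ g ∈ G, g α = β

/-- `(G,Ω)` is o-2 transitive. -/
def IsO2Transitive (G : Subgroup (Ω ≃o Ω)) : Prop :=
  ∀ α₁ α₂ β₁ β₂ : Ω, α₁ < α₂ → β₁ < β₂ → ∃ g ∈ G, g α₁ = β₁ ∧ g α₂ = β₂

/-- A convex `G`-congruence: an equivalence relation with convex classes which is
preserved by the action of `G`. -/
def IsConvexCongruence (G : Subgroup (Ω ≃o Ω)) (r : Ω → Ω → Prop) : Prop :=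
  Equivalence r ∧ (∀ α β γ : Ω, r α γ → α ≤ β → β ≤ γ → r α β) ∧
    ∀ g ∈ G, ∀ α β : Ω, r α β → r (g α) (g β)

/-- `V(α,β)`: the intersection of all convex `G`-congruences under which `α` and `β`
are equivalent. -/
def Vcong (G : Subgroup (Ω ≃o Ω)) (α β : Ω) : Ω → Ω → Prop :=
  fun γ δ => ∀ r : Ω → Ω → Prop, IsConvexCongruence G r → r α β → r γ δ

/-- Membership in the spine `𝔎` of `(G,Ω)`. -/
def SpineMem (G : Subgroup (Ω ≃o Ω)) (r : Ω → Ω → Prop) : Prop :=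
  ∃ α β : Ω, α ≠ β ∧ r = Vcong G α β

/-- Inclusion of relations. -/
def relLe (r s : Ω → Ω → Prop) : Prop := ∀ x y : Ω, r x y → s x y

/-- `Δ ∈ T`: `Δ` is an o-block (class) of a member of the spine `𝔎`. -/
def InT (G : Subgroup (Ω ≃o Ω)) (Δ : Set Ω) : Prop :=
  ∃ r : Ω → Ω → Prop, SpineMem G r ∧ ∃ δ : Ω, Δ = {γ | r δ γ}

/-- `Δ` is a class (o-block) of the relation `r`. -/
def IsBlockOf (r : Ω → Ω → Prop) (Δ : Set Ω) : Prop :=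
  ∃ δ : Ω, Δ = {γ | r δ γ}

/-- The restricted stabiliser `rst(S) = {g ∈ G ∣ supp g ⊆ S}`. -/
def rst (G : Subgroup (Ω ≃o Ω)) (S : Set Ω) : Set (Ω ≃o Ω) :=
  {g | g ∈ G ∧ supp g ⊆ S}

/-- The (setwise) stabiliser `st(Δ) = {g ∈ G ∣ Δg = Δ}`. -/
def stab (G : Subgroup (Ω ≃o Ω)) (Δ : Set Ω) : Set (Ω ≃o Ω) :=
  {g | g ∈ G ∧ g '' Δ = Δ}

/-- `Q_Δ = {h ∈ rst(Δ) ∣ ∃ α ∈ Δ, V(α, αh) = κ(Δ)}`; since `κ(Δ)` is the unique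
convex congruence having `Δ` as a class, the condition `V(α,αh) = κ(Δ)` says exactly
that `Δ` is the class of `V(α, αh)` containing `α`. -/
def Qset (G : Subgroup (Ω ≃o Ω)) (Δ : Set Ω) : Set (Ω ≃o Ω) :=
  {h | h ∈ rst G Δ ∧ ∃ α ∈ Δ, Δ = {γ | Vcong G α (h α) α γ}}

/-- `(G,Ω)` is ample: `Q_Δ ≠ ∅` for every `Δ ∈ T`. -/
def Ample (G : Subgroup (Ω ≃o Ω)) : Prop :=
  ∀ Δ : Set Ω, InT G Δ → (Qset G Δ).Nonempty

/-- `(G,Ω)` is abundant: for every `Δ ∈ T` and `g ∈ st(Δ)`, the automorphism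
`dep(g,Δ)` agreeing with `g` on `Δ` and with the identity elsewhere lies in `G`. -/
def Abundant (G : Subgroup (Ω ≃o Ω)) : Prop :=
  ∀ Δ : Set Ω, InT G Δ → ∀ g ∈ stab G Δ,
    ∃ g₀ ∈ G, (∀ α ∈ Δ, g₀ α = g α) ∧ ∀ α ∉ Δ, g₀ α = α

/-- The spine `𝔎` has no minimal element. -/
def SpineNoMin (G : Subgroup (Ω ≃o Ω)) : Prop :=
  ∀ r : Ω → Ω → Prop, SpineMem G r →
    ∃ r' : Ω → Ω → Prop, SpineMem G r' ∧ relLe r' r ∧ r' ≠ r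

/-- `Δ` is a minimal element of `T`. -/
def MinimalInT (G : Subgroup (Ω ≃o Ω)) (Δ : Set Ω) : Prop :=
  InT G Δ ∧ ∀ Δ' : Set Ω, InT G Δ' → Δ' ⊆ Δ → Δ' = Δ

/-- Hypothesis (†): if `T` has a minimal element `Δ₀`, then every (nondegenerate
bounded) interval of `Δ₀` supports a non-trivial element of `G`. -/
def Dagger (G : Subgroup (Ω ≃o Ω)) : Prop :=
  ∀ Δ₀ : Set Ω, MinimalInT G Δ₀ → ∀ α β : Ω, α ∈ Δ₀ → β ∈ Δ₀ → α < β →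
    ∃ g : Ω ≃o Ω, g ∈ G ∧ g ≠ 1 ∧ supp g ⊆ Set.Ioo α β

/-- `X_h = {[h⁻¹, h^g] ∣ g ∈ G}`. -/
def Xset (G : Subgroup (Ω ≃o Ω)) (h : Ω ≃o Ω) : Set (Ω ≃o Ω) :=
  {x | ∃ g ∈ G, x = pcomm h⁻¹ (aconj h g)}

/-- `W_h = ⋃ {X_{h^g} ∣ g ∈ G, [X_h, X_{h^g}] ≠ 1}`. -/
def Wset (G : Subgroup (Ω ≃o Ω)) (h : Ω ≃o Ω) : Set (Ω ≃o Ω) :=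
  {x | ∃ g ∈ G, (∃ a ∈ Xset G h, ∃ b ∈ Xset G (aconj h g), pcomm a b ≠ 1) ∧
    x ∈ Xset G (aconj h g)}

/-- The centraliser of a subset `S` in `G`. -/
def cent (G : Subgroup (Ω ≃o Ω)) (S : Set (Ω ≃o Ω)) : Set (Ω ≃o Ω) :=
  {f | f ∈ G ∧ ∀ s ∈ S, s * f = f * s}

/-- The double centraliser of a subset `S` in `G`. -/
def cent2 (G : Subgroup (Ω ≃o Ω)) (S : Set (Ω ≃o Ω)) : Set (Ω ≃o Ω) :=
  cent G (cent G S)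

/-- The pointwise stabiliser in `G` of a subset `S ⊆ Ω`. -/
def ptStab (G : Subgroup (Ω ≃o Ω)) (S : Set Ω) : Set (Ω ≃o Ω) :=
  {f | f ∈ G ∧ ∀ α ∈ S, f α = α}

/-- The congruence covered by `K`: the union of all convex `G`-congruences properly
contained in `K`. -/
def coveredRel (G : Subgroup (Ω ≃o Ω)) (K : Ω → Ω → Prop) : Ω → Ω → Prop :=
  fun γ δ => ∃ r : Ω → Ω → Prop, IsConvexCongruence G r ∧ relLe r K ∧ r ≠ K ∧ r γ δ

/-- `Γ ∈ π(Δ)`, where `K = κ(Δ)`: `Γ` is a class of the congruence covered by `K`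
contained in `Δ`. -/
def InPi (G : Subgroup (Ω ≃o Ω)) (K : Ω → Ω → Prop) (Δ Γ : Set Ω) : Prop :=
  ∃ δ ∈ Δ, Γ = {γ | coveredRel G K δ γ}

/-- An irreducible element of `G`. -/
def IsIrreducibleElt (G : Subgroup (Ω ≃o Ω)) (g : Ω ≃o Ω) : Prop :=
  autLe 1 g ∧ g ≠ 1 ∧
    ∀ g₁ g₂ : Ω ≃o Ω, g₁ ∈ G → g₂ ∈ G → autSup g₁ g₂ = g → autInf g₁ g₂ = 1 →
      g₁ = 1 ∨ g₂ = 1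

/-- `(G,Ω)` is controlled. -/
def Controlled (G : Subgroup (Ω ≃o Ω)) : Prop :=
  ∀ Δ : Set Ω, InT G Δ → ¬ MinimalInT G Δ → ∀ g ∈ rst G Δ,
    (∃ δ ∈ Δ ∩ supp g, Δ = {γ | Vcong G δ (g δ) δ γ}) ∨
      ∃ Δ' : Set Ω, InT G Δ' ∧ supp g ⊆ Δ' ∧ Δ' ⊂ Δ


section Helpers

variable {Ω : Type*} [LinearOrder Ω] {G : Subgroup (Ω ≃o Ω)}

theorem isConvexCongruence_Vcong (G : Subgroup (Ω ≃o Ω)) (a b : Ω) :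
    IsConvexCongruence G (Vcong G a b) := by
  refine ⟨⟨fun x r hr _ => hr.1.refl x, fun h r hr hab => hr.1.symm (h r hr hab),
    fun h₁ h₂ r hr hab => hr.1.trans (h₁ r hr hab) (h₂ r hr hab)⟩, ?_, ?_⟩
  · intro x y z hxz hxy hyz r hr hab
    exact hr.2.1 x y z (hxz r hr hab) hxy hyz
  · intro g hg x y hxy r hr hab
    exact hr.2.2 g hg x y (hxy r hr hab)

theorem Vcong_self (G : Subgroup (Ω ≃o Ω)) (a b : Ω) : Vcong G a b a b :=
  fun _ _ hab => hab

theorem inT_class {a b : Ω} (hab : a ≠ b) (z : Ω) : InT G {x | Vcong G a b z x} :=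
  ⟨_, ⟨a, b, hab, rfl⟩, z, rfl⟩

namespace IsConvexCongruence

variable {r : Ω → Ω → Prop}

theorem map_iff (hr : IsConvexCongruence G r) {g : Ω ≃o Ω} (hg : g ∈ G) (x y : Ω) :
    r (g x) (g y) ↔ r x y := by
  refine ⟨fun h => ?_, hr.2.2 g hg x y⟩
  simpa using hr.2.2 g⁻¹ (G.inv_mem hg) _ _ h

/-- A point of a class lies strictly below every point of a higher class. -/
theorem lt_of_class_lt (hr : IsConvexCongruence G r) {x x' y y' : Ω} (hxy : x < y)
    (hn : ¬ r x y) (hx : r x x') (hy : r y y') : x' < y' := by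
  by_contra! hle
  apply hn
  rcases le_total x y' with h | h
  · exact hr.1.trans (hr.2.1 x y' x' hx h hle) (hr.1.symm hy)
  · exact hr.1.trans (hr.1.symm (hr.2.1 y' x y (hr.1.symm hy) h hxy.le)) (hr.1.symm hy)

/-- Inclusion of a single class of one congruence in a class of another one spreads to all
classes by transitivity. -/
theorem le_of_class_subset {s : Ω → Ω → Prop} (hr : IsConvexCongruence G r)
    (hs : IsConvexCongruence G s) (htrans : IsTransitive G) {e : Ω}
    (h : ∀ x, r e x → s e x) {x y : Ω} (hxy : r x y) : s x y := by
  obtain ⟨g, hg, hge⟩ := htrans x e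
  rw [← hs.map_iff hg, hge]
  apply h
  rw [← hge]
  exact (hr.map_iff hg x y).2 hxy

end IsConvexCongruence

theorem exists_lt_of_Vcong (htrans : IsTransitive G) {a b : Ω} (hab : a ≠ b) (z : Ω) :
    ∃ q, z < q ∧ Vcong G a b z q := by
  have hV := isConvexCongruence_Vcong G a b
  rcases lt_or_gt_of_ne hab with h | h
  · obtain ⟨g, hg, rfl⟩ := htrans a z
    exact ⟨g b, g.lt_iff_lt.2 h, hV.2.2 g hg _ _ (Vcong_self G a b)⟩
  · obtain ⟨g, hg, rfl⟩ := htrans b z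
    exact ⟨g a, g.lt_iff_lt.2 h, hV.2.2 g hg _ _ (hV.1.symm (Vcong_self G a b))⟩

theorem exists_ne_one_supp_subset (htrans : IsTransitive G) (habund : Abundant G) {a b : Ω}
    (hab : a ≠ b) (z : Ω) : ∃ k ∈ G, k ≠ 1 ∧ ∀ x, k x ≠ x → Vcong G a b z x := by
  have hV := isConvexCongruence_Vcong G a b
  obtain ⟨q, hzq, hq⟩ := exists_lt_of_Vcong htrans hab z
  obtain ⟨g, hg, hgz⟩ := htrans z q
  have hst : g ∈ stab G {x | Vcong G a b z x} := by
    refine ⟨hg, Set.Subset.antisymm ?_ ?_⟩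
    · rintro _ ⟨x, hx, rfl⟩
      have := hV.2.2 g hg _ _ hx
      rw [hgz] at this
      exact hV.1.trans hq this
    · intro y hy
      refine ⟨g⁻¹ y, ?_, by simp⟩
      have : Vcong G a b (g z) (g (g⁻¹ y)) := by
        rw [hgz, RelIso.apply_inv_self]
        exact hV.1.trans (hV.1.symm hq) hy
      exact (hV.map_iff hg _ _).1 this
  obtain ⟨k, hk, hk1, hk2⟩ := habund _ (inT_class hab z) g hst
  refine ⟨k, hk, ?_, fun x hx => ?_⟩
  · rintro rfl
    have := hk1 z (hV.1.refl z)
    rw [hgz] at this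
    exact hzq.ne this
  · by_contra hc
    exact hx (hk2 x hc)

theorem exists_moved {k : Ω ≃o Ω} (hk : k ≠ 1) : ∃ x, k x ≠ x := by
  by_contra! h
  exact hk (RelIso.ext h)

/-- A set carrying two non-trivial elements of `G`, one supported below the other. -/
def CarriesPair (G : Subgroup (Ω ≃o Ω)) (I : Set Ω) : Prop :=
  ∃ k ∈ G, ∃ k' ∈ G, k ≠ 1 ∧ k' ≠ 1 ∧ supp k ⊆ I ∧ supp k' ⊆ I ∧
    ∀ x ∈ supp k, ∀ y ∈ supp k', x < y

theorem carriesPair_of_minimal (hdag : Dagger G) {D : Set Ω} (hD : MinimalInT G D) {a b : Ω}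
    (ha : a ∈ D) (hb : b ∈ D) (hab : a < b) : CarriesPair G (Set.Ioo a b) := by
  obtain ⟨g, -, hg1, hgs⟩ := hdag D hD a b ha hb hab
  obtain ⟨q, hq⟩ := exists_moved hg1
  obtain ⟨haq, hqb⟩ := hgs hq
  have hqD : q ∈ D := by
    obtain ⟨_, ⟨c, d, -, rfl⟩, e, rfl⟩ := hD.1
    have hV := isConvexCongruence_Vcong G c d
    exact hV.1.trans ha (hV.2.1 a q b (hV.1.trans (hV.1.symm ha) hb) haq.le hqb.le)
  obtain ⟨k, hk, hk1, hks⟩ := hdag D hD a q ha hqD haq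
  obtain ⟨k', hk', hk1', hks'⟩ := hdag D hD q b hqD hb hqb
  exact ⟨k, hk, k', hk', hk1, hk1', fun x hx => ⟨(hks hx).1, (hks hx).2.trans hqb⟩,
    fun x hx => ⟨haq.trans (hks' hx).1, (hks' hx).2⟩,
    fun x hx y hy => (hks hx).2.trans (hks' hy).1⟩

theorem carriesPair_of_inT (htrans : IsTransitive G) (habund : Abundant G) (hdag : Dagger G)
    {D : Set Ω} (hD : InT G D) : CarriesPair G D := by
  by_cases hmin : MinimalInT G D
  · obtain ⟨_, ⟨c, d, hcd, rfl⟩, e, rfl⟩ := hD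
    have hV := isConvexCongruence_Vcong G c d
    obtain ⟨q, heq, hq⟩ := exists_lt_of_Vcong htrans hcd e
    obtain ⟨k, hk, k', hk', h1, h1', hs, hs', hlt⟩ :=
      carriesPair_of_minimal hdag hmin (hV.1.refl e) hq heq
    have hsub : Set.Ioo e q ⊆ {x | Vcong G c d e x} :=
      fun x hx => hV.2.1 e x q hq hx.1.le hx.2.le
    exact ⟨k, hk, k', hk', h1, h1', hs.trans hsub, hs'.trans hsub, hlt⟩
  · have : ∃ D', InT G D' ∧ D' ⊆ D ∧ D' ≠ D := by
      by_contra! hc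
      exact hmin ⟨hD, hc⟩
    obtain ⟨D', hD', hsub, hne⟩ := this
    obtain ⟨z, hzD, hzD'⟩ := Set.exists_of_ssubset (hsub.ssubset_of_ne hne)
    obtain ⟨_, ⟨c, d, hcd, rfl⟩, e, rfl⟩ := hD
    obtain ⟨_, ⟨c', d', hcd', rfl⟩, e', rfl⟩ := hD'
    have hV := isConvexCongruence_Vcong G c d
    have hV' := isConvexCongruence_Vcong G c' d'
    have hee' : Vcong G c d e e' := hsub (hV'.1.refl e')
    have hle : ∀ {x y}, Vcong G c' d' x y → Vcong G c d x y := fun h =>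
      hV'.le_of_class_subset hV htrans (e := e')
        (fun x hx => hV.1.trans (hV.1.symm hee') (hsub hx)) h
    obtain ⟨k, hk, hk1, hks⟩ := exists_ne_one_supp_subset htrans habund hcd' e'
    obtain ⟨k', hk', hk1', hks'⟩ := exists_ne_one_supp_subset htrans habund hcd' z
    have hke : supp k ⊆ {x | Vcong G c d e x} := fun x hx => hV.1.trans hee' (hle (hks x hx))
    have hkz : supp k' ⊆ {x | Vcong G c d e x} := fun x hx => hV.1.trans hzD (hle (hks' x hx))
    have hez : e' ≠ z := by
      rintro rfl
      exact hzD' (hV'.1.refl _)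
    rcases lt_or_gt_of_ne hez with h | h
    · exact ⟨k, hk, k', hk', hk1, hk1', hke, hkz, fun x hx y hy =>
        hV'.lt_of_class_lt h hzD' (hks x hx) (hks' y hy)⟩
    · exact ⟨k', hk', k, hk, hk1', hk1, hkz, hke, fun x hx y hy =>
        hV'.lt_of_class_lt h (fun hc => hzD' (hV'.1.symm hc)) (hks' x hx) (hks y hy)⟩

/-- Close to any point there is a set carrying a pair of non-trivial elements which is moved
above itself by every element of `G` moving the point up to `p` or beyond. -/
theorem exists_carriesPair (htrans : IsTransitive G) (habund : Abundant G) (hdag : Dagger G)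
    {δ p : Ω} (hδp : δ < p) :
    ∃ I : Set Ω, CarriesPair G I ∧ (∀ x ∈ I, Vcong G δ p δ x) ∧
      ∀ g ∈ G, p ≤ g δ → ∀ x ∈ I, ∀ y ∈ I, y < g x := by
  have hV := isConvexCongruence_Vcong G δ p
  have hD : InT G {x | Vcong G δ p δ x} := inT_class hδp.ne δ
  by_cases hmin : MinimalInT G {x | Vcong G δ p δ x}
  · refine ⟨Set.Ioo δ p,
      carriesPair_of_minimal hdag hmin (hV.1.refl δ) (Vcong_self G δ p) hδp,
      fun x hx => hV.2.1 δ x p (Vcong_self G δ p) hx.1.le hx.2.le, ?_⟩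
    intro g _ hpg x hx y hy
    exact hy.2.trans (hpg.trans_lt (g.lt_iff_lt.2 hx.1))
  · have : ∃ D', InT G D' ∧ D' ⊆ {x | Vcong G δ p δ x} ∧ D' ≠ {x | Vcong G δ p δ x} := by
      by_contra! hc
      exact hmin ⟨hD, hc⟩
    obtain ⟨D', ⟨_, ⟨a, b, hab, rfl⟩, e, rfl⟩, hsub, hne⟩ := this
    have hV' := isConvexCongruence_Vcong G a b
    have hδe : Vcong G δ p δ e := hsub (hV'.1.refl e)
    have hnot : ¬ Vcong G a b δ p := by
      intro hc
      apply hne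
      refine hsub.antisymm fun x hx => ?_
      exact hV.1.trans (hV.1.symm hδe) hx _ hV' hc
    refine ⟨{x | Vcong G a b δ x}, carriesPair_of_inT htrans habund hdag (inT_class hab δ),
      fun x hx => hV'.le_of_class_subset hV htrans (e := e)
        (fun x hx => hV.1.trans (hV.1.symm hδe) (hsub hx)) hx, ?_⟩
    intro g hg hpg x hx y hy
    exact hV'.lt_of_class_lt (hδp.trans_le hpg)
      (fun hc => hnot (hV'.2.1 δ p (g δ) hc hδp.le hpg)) hy (hV'.2.2 g hg _ _ hx)

theorem commute_apply {f k : Ω ≃o Ω} (h : k * f = f * k) (x : Ω) : k (f x) = f (k x) :=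
  DFunLike.congr_fun h x

theorem inv_commute {f k : Ω ≃o Ω} (h : k * f = f * k) : k * f⁻¹ = f⁻¹ * k :=
  (Commute.inv_right (show Commute k f from h))

/-- An element moving a point fails to commute with some element supported in any prescribed
block around that point. -/
theorem exists_not_commute (htrans : IsTransitive G) (habund : Abundant G) (hdag : Dagger G)
    {a b : Ω} (hab : a ≠ b) {f : Ω ≃o Ω} (hf : f ∈ G) {δ : Ω} (hδ : f δ ≠ δ) :
    ∃ k ∈ G, (∀ x, k x ≠ x → Vcong G a b δ x) ∧ k * f ≠ f * k := by
  wlog hlt : δ < f δ generalizing f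
  · have hlt' : δ < f⁻¹ δ := by
      rw [← f.lt_iff_lt, RelIso.apply_inv_self]
      exact lt_of_le_of_ne (not_lt.1 hlt) hδ
    obtain ⟨k, hk, hks, hkf⟩ := this (G.inv_mem hf) hlt'.ne' hlt'
    exact ⟨k, hk, hks, fun h => hkf (inv_commute h)⟩
  have hV := isConvexCongruence_Vcong G a b
  obtain ⟨q, hδq, hq⟩ := exists_lt_of_Vcong htrans hab δ
  obtain ⟨I, ⟨k, hk, -, -, hk1, -, hks, -, -⟩, hI, hIg⟩ :=
    exists_carriesPair htrans habund hdag (lt_min hδq hlt)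
  have hV' : Vcong G a b δ (min q (f δ)) :=
    hV.2.1 δ _ q hq (lt_min hδq hlt).le (min_le_left _ _)
  refine ⟨k, hk, fun x hx => hI x (hks hx) _ hV hV', fun hc => ?_⟩
  obtain ⟨x, hx⟩ := exists_moved hk1
  have hfx : f x ∈ supp k := by
    intro h
    rw [commute_apply hc] at h
    exact hx (f.injective h)
  exact (hIg f hf (min_le_right _ _) x (hks hx) _ (hks hfx)).ne rfl

theorem Xset_subset {h : Ω ≃o Ω} (hh : h ∈ G) : ∀ x ∈ Xset G h, x ∈ G := by
  rintro _ ⟨g, hg, rfl⟩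
  have h1 : aconj h g ∈ G := G.mul_mem (G.mul_mem (G.inv_mem hg) hh) hg
  exact G.mul_mem (G.mul_mem (G.mul_mem (G.inv_mem (G.inv_mem hh)) (G.inv_mem h1))
    (G.inv_mem hh)) h1

theorem pcomm_aconj_apply (h k : Ω ≃o Ω) (y : Ω) :
    pcomm h⁻¹ (aconj h k) y = h (k⁻¹ (h⁻¹ (k (h⁻¹ (k⁻¹ (h (k y))))))) := by
  simp [pcomm, aconj, mul_inv_rev, mul_assoc, RelIso.mul_apply]

theorem inv_apply_eq_self_iff {k : Ω ≃o Ω} {x : Ω} : k⁻¹ x = x ↔ k x = x := by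
  constructor
  · intro h
    conv_lhs => rw [← h]
    simp
  · intro h
    conv_lhs => rw [← h]
    simp

theorem apply_apply_ne {k : Ω ≃o Ω} {x : Ω} (h : k x ≠ x) : k (k x) ≠ x := by
  rcases lt_or_gt_of_ne h with h | h
  · exact ((k.lt_iff_lt.2 h).trans h).ne
  · exact (h.trans (k.lt_iff_lt.2 h)).ne'

/-- If `k` has support disjoint from its translates under `h`, `h⁻¹` and `h⁻²`, then the
commutator `[h⁻¹, h^k]` moves exactly the points of `supp k` and its two neighbours. -/
theorem pcomm_aconj_apply_ne_iff {h k : Ω ≃o Ω}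
    (h1 : ∀ z, k z ≠ z → k (h z) = h z) (h2 : ∀ z, k z ≠ z → k (h⁻¹ z) = h⁻¹ z)
    (h3 : ∀ z, k z ≠ z → k (h⁻¹ (h⁻¹ z)) = h⁻¹ (h⁻¹ z)) (y : Ω) :
    pcomm h⁻¹ (aconj h k) y ≠ y ↔ k y ≠ y ∨ k (h y) ≠ h y ∨ k (h⁻¹ y) ≠ h⁻¹ y := by
  rw [pcomm_aconj_apply]
  by_cases hy : k y = y
  · rw [hy]
    by_cases hhy : k (h y) = h y
    · rw [inv_apply_eq_self_iff.2 hhy, RelIso.inv_apply_self, hy]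
      simp only [hhy, ne_eq, not_true_eq_false, false_or]
      rw [← inv_apply_eq_self_iff (k := k), not_iff_not,
        ← h.injective.eq_iff (a := k⁻¹ (h⁻¹ y)), RelIso.apply_inv_self]
    · simp only [hhy, ne_eq, not_true_eq_false, not_false_eq_true, true_or, or_true,
        iff_true]
      have hw : k (k⁻¹ (h y)) ≠ k⁻¹ (h y) := by
        intro hc
        rw [RelIso.apply_inv_self] at hc
        exact hhy (inv_apply_eq_self_iff.1 hc.symm)
      rw [h2 _ hw, inv_apply_eq_self_iff.2 (h3 _ hw), RelIso.apply_inv_self]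
      intro hc
      apply hhy
      rw [← inv_apply_eq_self_iff]
      conv_rhs => rw [← hc]
      simp
  · simp only [hy, ne_eq, not_false_eq_true, true_or, iff_true]
    have hky : k (k y) ≠ k y := fun hc => hy (k.injective hc)
    have hkky : k (k (k y)) ≠ k (k y) := fun hc => hky (k.injective hc)
    rw [inv_apply_eq_self_iff.2 (h1 _ hky), RelIso.inv_apply_self,
      inv_apply_eq_self_iff.2 (h2 _ hkky), RelIso.apply_inv_self]
    exact apply_apply_ne hy

/-- The possible support of `[h⁻¹, h^k]`. -/
def nbhdMoved (h k : Ω ≃o Ω) (y : Ω) : Prop :=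
  k y ≠ y ∨ k (h y) ≠ h y ∨ k (h⁻¹ y) ≠ h⁻¹ y

theorem nbhdMoved_inv {h k : Ω ≃o Ω} {y : Ω} : nbhdMoved h⁻¹ k y ↔ nbhdMoved h k y := by
  unfold nbhdMoved
  rw [inv_inv, or_comm (a := k (h⁻¹ y) ≠ h⁻¹ y)]

theorem disjoint_translates {u k : Ω ≃o Ω} {I : Set Ω} (hk : supp k ⊆ I)
    (hI : ∀ x ∈ I, ∀ y ∈ I, y < u x) (z : Ω) (hz : k z ≠ z) :
    k (u z) = u z ∧ k (u (u z)) = u (u z) ∧ k (u⁻¹ z) = u⁻¹ z ∧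
      k (u⁻¹ (u⁻¹ z)) = u⁻¹ (u⁻¹ z) := by
  have hzI := hk hz
  have hzz := hI z hzI z hzI
  refine ⟨?_, ?_, ?_, ?_⟩ <;> by_contra hc <;> have hc := hk hc
  · exact (hI z hzI _ hc).ne rfl
  · exact ((hI z hzI _ hc).trans (u.lt_iff_lt.2 hzz)).ne rfl
  · have := hI _ hc z hzI
    simp at this
  · have h1 := hI _ hc z hzI
    have h2 := hI _ hc _ hc
    rw [← u.lt_iff_lt, RelIso.apply_inv_self] at h2
    rw [RelIso.apply_inv_self] at h1 h2
    exact (h1.trans h2).ne (by simp)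

theorem false_of_nbhdMoved (htrans : IsTransitive G) (habund : Abundant G) (hdag : Dagger G)
    {u f : Ω ≃o Ω} (hu : u ∈ G) (hf : f ∈ G) {δ : Ω} (hδu : δ < u δ) (hδf : δ < f δ)
    (hmoved : ∀ k ∈ G, ∀ I : Set Ω, supp k ⊆ I → (∀ x ∈ I, ∀ y ∈ I, y < u x) →
      ∀ y, nbhdMoved u k y → nbhdMoved u k (f y)) : False := by
  obtain ⟨I, ⟨k, hk, k', hk', hk1, hk1', hks, hks', hlt⟩, -, hIg⟩ :=
    exists_carriesPair htrans habund hdag (lt_min hδu hδf)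
  have hIu := hIg u hu (min_le_left _ _)
  have hIf := hIg f hf (min_le_right _ _)
  obtain ⟨a, ha⟩ := exists_moved hk1
  obtain ⟨a', ha'⟩ := exists_moved hk1'
  have haI := hks ha
  have haI' := hks' ha'
  have above : ∀ {w : Ω}, (∀ y ∈ I, y < w) → ∀ y ∈ I, y < u w := by
    intro w hw y hy
    exact (hIu a haI y hy).trans (u.lt_iff_lt.2 (hw a haI))
  have key : ∀ l : Ω ≃o Ω, supp l ⊆ I → ∀ w, (∀ y ∈ I, y < w) → nbhdMoved u l w →
      u⁻¹ w ∈ supp l := by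
    rintro l hl w hw (h | h | h)
    · exact ((hw w (hl h)).ne rfl).elim
    · exact ((above hw _ (hl h)).ne rfl).elim
    · exact h
  have h1 : u⁻¹ (f a') ∈ supp k' :=
    key k' hks' _ (hIf a' haI') (hmoved k' hk' I hks' hIu a' (Or.inl ha'))
  have haa' : a' < u a := hIu a haI a' haI'
  have h2 : u⁻¹ (f (u a)) ∈ supp k := by
    refine key k hks _ (fun y hy => (hIf a' haI' y hy).trans (f.lt_iff_lt.2 haa')) ?_
    refine hmoved k hk I hks hIu (u a) (Or.inr (Or.inr ?_))
    rwa [RelIso.inv_apply_self]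
  have h3 := hlt _ h2 _ h1
  rw [(u⁻¹).lt_iff_lt, f.lt_iff_lt] at h3
  exact h3.asymm haa'

/-- The centraliser of `X_h` fixes the support of `h` pointwise. -/
theorem apply_eq_of_commute_Xset (htrans : IsTransitive G) (habund : Abundant G)
    (hdag : Dagger G) {h f : Ω ≃o Ω} (hh : h ∈ G) (hf : f ∈ G)
    (hc : ∀ x ∈ Xset G h, x * f = f * x) {δ : Ω} (hδ : h δ ≠ δ) : f δ = δ := by
  by_contra hfδ
  wlog hlt : δ < f δ generalizing f
  · have hlt' : δ < f⁻¹ δ := by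
      rw [← f.lt_iff_lt, RelIso.apply_inv_self]
      exact lt_of_le_of_ne (not_lt.1 hlt) hfδ
    exact this (G.inv_mem hf) (fun x hx => inv_commute (hc x hx)) hlt'.ne' hlt'
  have hmove : ∀ k ∈ G, (∀ y, pcomm h⁻¹ (aconj h k) y ≠ y ↔ nbhdMoved h k y) →
      ∀ y, nbhdMoved h k y → nbhdMoved h k (f y) := by
    intro k hk hiff y hy
    rw [← hiff] at hy ⊢
    rw [commute_apply (hc _ ⟨k, hk, rfl⟩)]
    exact fun h' => hy (f.injective h')
  rcases lt_or_gt_of_ne hδ with hlt' | hlt'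
  · have hδu : δ < h⁻¹ δ := by
      rw [← h.lt_iff_lt, RelIso.apply_inv_self]
      exact hlt'
    refine false_of_nbhdMoved htrans habund hdag (G.inv_mem hh) hf hδu hlt ?_
    intro k hk I hks hI y hy
    rw [nbhdMoved_inv] at hy ⊢
    have hd := disjoint_translates hks hI
    simp only [inv_inv] at hd
    exact hmove k hk (pcomm_aconj_apply_ne_iff (fun z hz => (hd z hz).2.2.1)
      (fun z hz => (hd z hz).1) (fun z hz => (hd z hz).2.1)) y hy
  · refine false_of_nbhdMoved htrans habund hdag hh hf hlt' hlt ?_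
    intro k hk I hks hI
    have hd := disjoint_translates hks hI
    exact hmove k hk (pcomm_aconj_apply_ne_iff (fun z hz => (hd z hz).1)
      (fun z hz => (hd z hz).2.2.1) (fun z hz => (hd z hz).2.2.2))

theorem commute_of_disjoint {f g : Ω ≃o Ω} (h : ∀ x, f x = x ∨ g x = x) : f * g = g * f := by
  ext x
  simp only [RelIso.mul_apply]
  rcases h x with hx | hx
  · rcases h (g x) with hg | hg
    · rw [hg, hx]
    · rw [g.injective hg, hx, g.injective hg]
  · rcases h (f x) with hf | hf
    · rw [hx, f.injective hf, hx]
    · rw [hx, hf]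

theorem pcomm_eq_one_iff {a b : Ω ≃o Ω} : pcomm a b = 1 ↔ a * b = b * a := by
  unfold pcomm
  rw [mul_assoc, ← mul_inv_rev, inv_mul_eq_one, eq_comm]

theorem aconj_mem {h g : Ω ≃o Ω} (hh : h ∈ G) (hg : g ∈ G) : aconj h g ∈ G :=
  G.mul_mem (G.mul_mem (G.inv_mem hg) hh) hg

/-- If the supports of `h` and `h'` meet, then `[X_h, X_{h'}] ≠ 1`. -/
theorem exists_pcomm_ne_one (htrans : IsTransitive G) (habund : Abundant G)
    (hdag : Dagger G) {h h' : Ω ≃o Ω} (hh : h ∈ G) (hh' : h' ∈ G) {α : Ω} (hα : h α ≠ α)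
    (hα' : h' α ≠ α) : ∃ a ∈ Xset G h, ∃ b ∈ Xset G h', pcomm a b ≠ 1 := by
  by_contra! hc
  refine hα (apply_eq_of_commute_Xset htrans habund hdag hh' hh (fun b hb => ?_) hα')
  refine commute_of_disjoint fun x => ?_
  by_contra! hx
  exact hx.1 (apply_eq_of_commute_Xset htrans habund hdag hh (Xset_subset hh' b hb)
    (fun a ha => pcomm_eq_one_iff.1 (hc a ha b hb)) hx.2)

/-- `z` lies above `x`, and not beyond the image of `x` under a conjugate of `h` or `h⁻¹`. -/
def StepUp (G : Subgroup (Ω ≃o Ω)) (h : Ω ≃o Ω) (x z : Ω) : Prop :=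
  x ≤ z ∧ ∃ g ∈ G, z ≤ aconj h g x ∨ z ≤ (aconj h g)⁻¹ x

theorem stepUp_map {h g : Ω ≃o Ω} (hg : g ∈ G) {x z : Ω} (hs : StepUp G h x z) :
    StepUp G h (g x) (g z) := by
  obtain ⟨hxz, k, hk, hz⟩ := hs
  refine ⟨g.le_iff_le.2 hxz, k * g⁻¹, G.mul_mem hk (G.inv_mem hg), ?_⟩
  have h1 : aconj h (k * g⁻¹) = g * aconj h k * g⁻¹ := by simp [aconj, mul_assoc]
  have h2 : (g * aconj h k * g⁻¹)⁻¹ = g * (aconj h k)⁻¹ * g⁻¹ := by simp [mul_assoc]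
  rw [h1, h2]
  simpa [RelIso.mul_apply] using hz

theorem stepUp_mono {h : Ω ≃o Ω} {x z x' z' : Ω} (hs : StepUp G h x z) (hx : x ≤ x')
    (hxz : x' ≤ z') (hz : z' ≤ z) : StepUp G h x' z' := by
  obtain ⟨-, k, hk, h⟩ := hs
  refine ⟨hxz, k, hk, h.imp (fun h => ?_) (fun h => ?_)⟩
  · exact (hz.trans h).trans ((aconj _ k).monotone hx)
  · exact (hz.trans h).trans (((aconj _ k)⁻¹).monotone hx)

open Relation in
theorem le_of_chain {h : Ω ≃o Ω} {x y : Ω} (hc : ReflTransGen (StepUp G h) x y) : x ≤ y := by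
  induction hc with
  | refl => exact le_rfl
  | tail _ hs ih => exact ih.trans hs.1

open Relation in
theorem chain_split {h : Ω ≃o Ω} {x y z : Ω} (hc : ReflTransGen (StepUp G h) x y)
    (hxz : x ≤ z) (hzy : z ≤ y) :
    ReflTransGen (StepUp G h) x z ∧ ReflTransGen (StepUp G h) z y := by
  induction hc using ReflTransGen.head_induction_on with
  | refl =>
    obtain rfl := hxz.antisymm hzy
    exact ⟨.refl, .refl⟩
  | head hs hc ih =>
    rename_i x w
    rcases le_total z w with hzw | hwz
    · exact ⟨.single (stepUp_mono hs le_rfl hxz hzw), .head (stepUp_mono hs hxz hzw le_rfl) hc⟩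
    · exact ⟨.head hs (ih hwz).1, (ih hwz).2⟩

open Relation in
/-- Any convex congruence containing `(α, hα)` contains the congruence joining points which are
linked by a chain of steps. -/
theorem chain_of_Vcong {h : Ω ≃o Ω} {α x y : Ω} (hV : Vcong G α (h α) x y) :
    ReflTransGen (StepUp G h) x y ∨ ReflTransGen (StepUp G h) y x := by
  refine hV (fun x y => ReflTransGen (StepUp G h) x y ∨ ReflTransGen (StepUp G h) y x)
    ⟨⟨fun _ => Or.inl .refl, fun h => h.symm, ?_⟩, ?_, ?_⟩ ?_
  · rintro a b c (h1 | h1) (h2 | h2)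
    · exact Or.inl (h1.trans h2)
    · rcases le_total a c with hac | hac
      · exact Or.inl (chain_split h1 hac (le_of_chain h2)).1
      · exact Or.inr (chain_split h2 hac (le_of_chain h1)).1
    · rcases le_total a c with hac | hac
      · exact Or.inl (chain_split h2 (le_of_chain h1) hac).2
      · exact Or.inr (chain_split h1 (le_of_chain h2) hac).2
    · exact Or.inr (h2.trans h1)
  · rintro a b c (h1 | h1) hab hbc
    · exact Or.inl (chain_split h1 hab hbc).1
    · obtain rfl : a = b := hab.antisymm (hbc.trans (le_of_chain h1))
      exact Or.inl .refl
  · intro g hg a b hab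
    exact hab.imp (fun hc => ReflTransGen.lift g (fun _ _ => stepUp_map hg) _ _ hc)
      (fun hc => ReflTransGen.lift g (fun _ _ => stepUp_map hg) _ _ hc)
  · rcases le_total α (h α) with hle | hle
    · exact Or.inl (.single ⟨hle, 1, G.one_mem, Or.inl (by simp [aconj])⟩)
    · exact Or.inr (.single ⟨hle, 1, G.one_mem, Or.inr (by simp [aconj])⟩)

open Relation in
/-- Points linked by a chain of steps are moved by a common conjugate of `h`. -/
theorem exists_aconj_moves (htrans : IsTransitive G) {h : Ω ≃o Ω} (hh : h ∈ G) (hne : h ≠ 1)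
    {x y α : Ω} (hc : ReflTransGen (StepUp G h) x y) (hx : x ≤ α) (hy : α ≤ y) :
    ∃ g ∈ G, aconj h g α ≠ α ∧ aconj h g y ≠ y := by
  obtain ⟨n, hn⟩ : ∃ n : ℕ, ∃ c : ℕ → Ω, c 0 = x ∧ c n = y ∧
      ∀ i < n, StepUp G h (c i) (c (i + 1)) := by
    clear hx hy
    induction hc using ReflTransGen.head_induction_on with
    | refl => exact ⟨0, fun _ => y, rfl, rfl, by simp⟩
    | head hs hc ih =>
      rename_i x w
      obtain ⟨n, c, hc0, hcn, hci⟩ := ih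
      refine ⟨n + 1, fun i => Nat.casesOn i x c, rfl, hcn, ?_⟩
      rintro (_ | i) hi
      · simpa [hc0] using hs
      · exact hci i (by omega)
  clear hc
  induction n generalizing x with
  | zero =>
    obtain ⟨c, hc0, hcn, -⟩ := hn
    obtain rfl : x = y := hc0.symm.trans hcn
    obtain rfl := hx.antisymm hy
    obtain ⟨b, hb⟩ := exists_moved hne
    obtain ⟨g, hg, hgx⟩ := htrans x b
    have : aconj h g x ≠ x := by
      intro hc
      apply hb
      simp only [aconj, RelIso.mul_apply, hgx] at hc
      have hc' := congrArg g hc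
      rwa [RelIso.apply_inv_self, hgx] at hc'
    exact ⟨g, hg, this, this⟩
  | succ n ih =>
    obtain ⟨c, rfl, rfl, hci⟩ := hn
    have hs := hci 0 (by omega)
    by_cases hle : c 1 ≤ α
    · exact ih hle ⟨fun i => c (i + 1), rfl, rfl, fun i hi => hci (i + 1) (by omega)⟩
    · push Not at hle
      obtain ⟨-, g, hg, hz⟩ := hs
      obtain ⟨u, huG, hu, hzu⟩ : ∃ u ∈ G, (∀ w, u w ≠ w → aconj h g w ≠ w) ∧
          c (0 + 1) ≤ u (c 0) := by
        rcases hz with hz | hz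
        · exact ⟨_, aconj_mem hh hg, fun w hw => hw, hz⟩
        · exact ⟨_, G.inv_mem (aconj_mem hh hg), fun w hw hw' =>
            hw (inv_apply_eq_self_iff.2 hw'), hz⟩
      by_cases hy' : u (c (n + 1)) = c (n + 1)
      · have hlow : u⁻¹ (c 1) ≤ α := by
          rw [← u.le_iff_le, RelIso.apply_inv_self]
          exact hzu.trans (u.monotone hx)
        refine ih hlow ⟨fun i => u⁻¹ (c (i + 1)), rfl, inv_apply_eq_self_iff.2 hy', ?_⟩
        exact fun i hi => stepUp_map (G.inv_mem huG) (hci (i + 1) (by omega))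
      · exact ⟨g, hg, hu _ ((hle.trans_le (hzu.trans (u.monotone hx))).ne'), hu _ hy'⟩

theorem Xset_supp_subset {r : Ω → Ω → Prop} (hr : IsConvexCongruence G r) {h : Ω ≃o Ω} {δ : Ω}
    (hs : ∀ y, h y ≠ y → r δ y) : ∀ x ∈ Xset G h, ∀ y, x y ≠ y → r δ y := by
  rintro _ ⟨g, hg, rfl⟩ y hy
  by_contra hny
  apply hy
  have hconj : ∀ z, aconj h g z ≠ z → r δ (g z) := by
    intro z hz
    apply hs
    intro hc
    apply hz
    simp [aconj, RelIso.mul_apply, hc]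
  by_cases hg' : r δ (g δ)
  · have hconj' : aconj h g y = y := by
      by_contra hz
      exact hny ((hr.map_iff hg _ _).1 (hr.1.trans (hr.1.symm hg') (hconj y hz)))
    have hy' : h y = y := by
      by_contra hz
      exact hny (hs y hz)
    simp only [pcomm, RelIso.mul_apply, inv_inv]
    rw [hconj', inv_apply_eq_self_iff.2 hy', inv_apply_eq_self_iff.2 hconj', hy']
  · have : pcomm h⁻¹ (aconj h g) = 1 := by
      rw [pcomm_eq_one_iff]
      refine commute_of_disjoint fun z => ?_
      by_contra! hz
      have h1 := hs z fun hc => hz.1 (inv_apply_eq_self_iff.2 hc)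
      have h2 := hr.2.2 g hg _ _ h1
      exact hg' (hr.1.trans (hconj z hz.2) (hr.1.symm h2))
    rw [this]
    rfl

theorem Wset_supp_subset {r : Ω → Ω → Prop} (hr : IsConvexCongruence G r) {h : Ω ≃o Ω} {δ : Ω}
    (hs : ∀ y, h y ≠ y → r δ y) : ∀ x ∈ Wset G h, ∀ y, x y ≠ y → r δ y := by
  rintro x ⟨g, hg, ⟨a, ha, b, hb, hab⟩, hx⟩ y hy
  have hsg : ∀ y, aconj h g y ≠ y → r (g⁻¹ δ) y := by
    intro z hz
    rw [← hr.map_iff hg, RelIso.apply_inv_self]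
    apply hs
    intro hc
    apply hz
    simp [aconj, RelIso.mul_apply, hc]
  have hmeet : r δ (g⁻¹ δ) := by
    by_contra hn
    apply hab
    rw [pcomm_eq_one_iff]
    refine commute_of_disjoint fun z => ?_
    by_contra! hz
    exact hn (hr.1.trans (Xset_supp_subset hr hs a ha z hz.1)
      (hr.1.symm (Xset_supp_subset hr hsg b hb z hz.2)))
  exact hr.1.trans hmeet (Xset_supp_subset hr hsg x hx y hy)

theorem cent_Wset_eq_ptStab (htrans : IsTransitive G) (habund : Abundant G) (hdag : Dagger G)
    {Δ : Set Ω} (hΔ : InT G Δ) {h : Ω ≃o Ω} (hh : h ∈ Qset G Δ) :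
    cent G (Wset G h) = ptStab G Δ := by
  obtain ⟨⟨hhG, hhs⟩, α, -, hαΔ⟩ := hh
  ext f
  constructor
  · rintro ⟨hf, hfc⟩
    refine ⟨hf, fun δ hδ => ?_⟩
    have hα : h α ≠ α := by
      intro hne
      obtain ⟨_, ⟨a, b, hab, rfl⟩, e, rfl⟩ := hΔ
      obtain ⟨q, hq, hVq⟩ := exists_lt_of_Vcong htrans hab e
      have hmem : ∀ x, Vcong G a b e x → x = α := by
        intro x hx
        have hx' : x ∈ {γ | Vcong G α (h α) α γ} := hαΔ ▸ hx
        have := hx' Eq ⟨⟨fun _ => rfl, Eq.symm, Eq.trans⟩,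
          fun x y z hxz hxy hyz => hxy.antisymm (hxz ▸ hyz),
          fun g _ x y hxy => hxy ▸ rfl⟩ hne.symm
        exact this.symm
      have h1 := hmem e ((isConvexCongruence_Vcong G a b).1.refl e)
      have h2 := hmem q hVq
      exact hq.ne (h1.trans h2.symm)
    have hne : h ≠ 1 := by
      rintro rfl
      exact hα rfl
    obtain ⟨g, hg, hgα, hgδ⟩ : ∃ g ∈ G, aconj h g α ≠ α ∧ aconj h g δ ≠ δ := by
      rw [hαΔ] at hδ
      rcases chain_of_Vcong hδ with hc | hc
      · exact exists_aconj_moves htrans hhG hne hc le_rfl (le_of_chain hc)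
      · obtain ⟨g, hg, h1, h2⟩ := exists_aconj_moves htrans hhG hne hc le_rfl (le_of_chain hc)
        exact ⟨g, hg, h2, h1⟩
    refine apply_eq_of_commute_Xset htrans habund hdag (aconj_mem hhG hg) hf (fun x hx => ?_) hgδ
    exact hfc x ⟨g, hg, exists_pcomm_ne_one htrans habund hdag hhG (aconj_mem hhG hg) hα hgα, hx⟩
  · rintro ⟨hf, hfix⟩
    refine ⟨hf, fun x hx => commute_of_disjoint fun y => ?_⟩
    by_contra! hy
    apply hy.2
    apply hfix
    rw [hαΔ]
    refine Wset_supp_subset (isConvexCongruence_Vcong G α (h α)) (fun z hz => ?_) x hx y hy.1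
    have hz' : z ∈ Δ := hhs hz
    rw [hαΔ] at hz'
    exact hz'

theorem cent_ptStab_eq_rst (htrans : IsTransitive G) (habund : Abundant G) (hdag : Dagger G)
    {Δ : Set Ω} (hΔ : InT G Δ) : cent G (ptStab G Δ) = rst G Δ := by
  ext f
  constructor
  · rintro ⟨hf, hfc⟩
    refine ⟨hf, fun δ hδ => ?_⟩
    by_contra hδΔ
    obtain ⟨_, ⟨a, b, hab, rfl⟩, e, rfl⟩ := hΔ
    have hV := isConvexCongruence_Vcong G a b
    obtain ⟨k, hk, hks, hkf⟩ := exists_not_commute htrans habund hdag hab hf hδ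
    refine hkf (hfc k ⟨hk, fun x hx => ?_⟩)
    by_contra hkx
    exact hδΔ (hV.1.trans hx (hV.1.symm (hks x hkx)))
  · rintro ⟨hf, hfs⟩
    refine ⟨hf, fun s hs => commute_of_disjoint fun x => ?_⟩
    by_contra! hx
    exact hx.1 (hs.2 x (hfs hx.2))

end Helpers

/-- (Corollary 5.5 of the paper.)  The condition
`V(β,βh') = κ(Δ)` is expressed by saying that `Δ` is the class of `V(β,βh')`
containing `β`. -/
theorem double_centralizer_eq_rst_dagger {Ω : Type*} [LinearOrder Ω]
    (G : Subgroup (Ω ≃o Ω)) (hlat : SublatticeClosed G)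
    (htrans : IsTransitive G) (habund : Abundant G) (hdag : Dagger G)
    (Δ : Set Ω) (hΔ : InT G Δ) (h : Ω ≃o Ω) (hh : h ∈ Qset G Δ) :
    cent2 G (Wset G h) = rst G Δ ∧
    (∀ β ∈ Δ, ∀ h' ∈ rst G Δ, Δ = {γ | Vcong G β (h' β) β γ} →
      cent2 G (Wset G h) = cent2 G (Wset G h')) ∧
    (∀ h' ∈ Qset G Δ, cent2 G (Wset G h) = cent2 G (Wset G h')) := by
  have key : ∀ k ∈ Qset G Δ, cent2 G (Wset G k) = rst G Δ := fun k hk => by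
    rw [cent2, cent_Wset_eq_ptStab htrans habund hdag hΔ hk,
      cent_ptStab_eq_rst htrans habund hdag hΔ]
  have key' : ∀ k ∈ Qset G Δ, cent2 G (Wset G h) = cent2 G (Wset G k) := fun k hk =>
    (key h hh).trans (key k hk).symm
  exact ⟨key h hh, fun β hβ h' hh' hV => key' h' ⟨hh', β, hβ, hV⟩, key'⟩

end LPerm
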